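/- arXiv:1109.3771 — 4 statements merged into one kernel-verified Lean document; each statement's English description precedes it below -/
import Mathlib

section
/- Let R be a ring with Jacobson radical J and let 0 → K →f→ M →g→ N → 0 be a short exact sequence of finitely generated R-modules such that f(J·K) = f(K) ∩ J·M. Suppose p : P → K and q : Q → N are projective covers. Then there exists an R-module homomorphism l : P ⊕ Q → M with l ∘ ι_P = f ∘ p and g ∘ l = q ∘ pr_Q (where ι_P is the inclusion of P and pr_Q the projection onto Q), such that l is surjective with ker l ⊆ J·(P ⊕ Q) (so l is a projective cover of M), and the induced sequence of kernels 0 → ker p → ker l → ker q → 0 is exact. -/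
/-- `jSMul I K` is the submodule `I·K` generated by the products `r • k`,
`r ∈ I`, `k ∈ K`. -/
def jSMul {R : Type} [Ring R] {M : Type} [AddCommGroup M] [Module R M]
    (I : Ideal R) (K : Submodule R M) : Submodule R M :=
  Submodule.span R {x : M | ∃ r ∈ I, ∃ k ∈ K, x = r • k}

/-- `jPowSMul I n K` is the submodule `Iⁿ·K`. -/
def jPowSMul {R : Type} [Ring R] {M : Type} [AddCommGroup M] [Module R M]
    (I : Ideal R) : ℕ → Submodule R M → Submodule R M
  | 0, K => K
  | n + 1, K => jSMul I (jPowSMul I n K)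

/-- The Jacobson radical of a ring. -/
abbrev jacobsonRad (R : Type) [Ring R] : Ideal R := Ideal.jacobson (⊥ : Ideal R)

/-- A minimal projective resolution `⋯ → P₁ → P₀ → X → 0`. -/
structure MinProjRes (R : Type) [Ring R] (J : Ideal R)
    (X : Type) [AddCommGroup X] [Module R X] where
  obj : ℕ → Type
  [addcomm : ∀ n, AddCommGroup (obj n)]
  [mod : ∀ n, Module R (obj n)]
  proj : ∀ n, Module.Projective R (obj n)
  fin : ∀ n, Module.Finite R (obj n)
  d : ∀ n, obj (n + 1) →ₗ[R] obj n
  aug : obj 0 →ₗ[R] X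
  aug_surj : Function.Surjective aug
  exact0 : LinearMap.range (d 0) = LinearMap.ker aug
  exact : ∀ n, LinearMap.range (d (n + 1)) = LinearMap.ker (d n)
  minimal0 : LinearMap.ker aug ≤ jSMul J ⊤
  minimal : ∀ n, LinearMap.ker (d n) ≤ jSMul J ⊤

attribute [instance] MinProjRes.addcomm MinProjRes.mod

/-- The syzygies of a minimal projective resolution: `P.syz n ⊆ Pₙ`
is the `(n+1)`-st syzygy `Ω^{n+1}(X) = ker dₙ`. -/
def MinProjRes.syz {R : Type} [Ring R] {J : Ideal R}
    {X : Type} [AddCommGroup X] [Module R X]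
    (P : MinProjRes R J X) : ∀ n, Submodule R (P.obj n)
  | 0 => LinearMap.ker P.aug
  | n + 1 => LinearMap.ker (P.d n)

/-- A projective cover of a finitely generated module. -/
structure ProjCover (R : Type) [Ring R] (J : Ideal R)
    (X : Type) [AddCommGroup X] [Module R X] where
  P : Type
  [addcomm : AddCommGroup P]
  [mod : Module R P]
  p : P →ₗ[R] X
  proj : Module.Projective R P
  fin : Module.Finite R P
  surj : Function.Surjective p
  ker_le : LinearMap.ker p ≤ jSMul J ⊤

attribute [instance] ProjCover.addcomm ProjCover.mod

/-- `R` is semiperfect: every finitely generated module has a projective cover. -/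
def Semiperfect (R : Type) [Ring R] : Prop :=
  ∀ (X : Type) [AddCommGroup X] [Module R X], Module.Finite R X →
    Nonempty (ProjCover R (jacobsonRad R) X)

/-- The minimal Horseshoe Lemma holds for the short exact sequence
`0 → K →f→ M →g→ N → 0`. -/
def MinimalHorseshoe {R : Type} [Ring R] (J : Ideal R)
    {K M N : Type} [AddCommGroup K] [Module R K] [AddCommGroup M] [Module R M]
    [AddCommGroup N] [Module R N] (f : K →ₗ[R] M) (g : M →ₗ[R] N) : Prop :=
  ∃ (P : MinProjRes R J K) (L : MinProjRes R J M) (Q : MinProjRes R J N)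
    (φ : ∀ n, P.obj n →ₗ[R] L.obj n) (ψ : ∀ n, L.obj n →ₗ[R] Q.obj n),
    L.aug ∘ₗ φ 0 = f ∘ₗ P.aug ∧
    Q.aug ∘ₗ ψ 0 = g ∘ₗ L.aug ∧
    (∀ n, L.d n ∘ₗ φ (n + 1) = φ n ∘ₗ P.d n) ∧
    (∀ n, Q.d n ∘ₗ ψ (n + 1) = ψ n ∘ₗ L.d n) ∧
    (∀ n, Function.Injective (φ n)) ∧
    (∀ n, Function.Surjective (ψ n)) ∧
    (∀ n, LinearMap.ker (ψ n) = LinearMap.range (φ n))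

/-- `X` is a quasi-`δ`-Koszul module. -/
def IsQuasiDeltaKoszul {R : Type} [Ring R] (J : Ideal R) (δ : ℕ → ℕ)
    (X : Type) [AddCommGroup X] [Module R X] : Prop :=
  ∃ P : MinProjRes R J X, ∀ n,
    P.syz n ≤ jPowSMul J (δ (n + 1) - δ n) ⊤ ∧
    jSMul J (P.syz n) = P.syz n ⊓ jPowSMul J (δ (n + 1) - δ n + 1) ⊤

/-- `X` is a quasi-Koszul module. -/
def IsQuasiKoszul {R : Type} [Ring R] (J : Ideal R)
    (X : Type) [AddCommGroup X] [Module R X] : Prop :=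
  ∃ P : MinProjRes R J X, ∀ n,
    jSMul J (P.syz n) = P.syz n ⊓ jPowSMul J 2 ⊤
theorem map_jSMul {R : Type} [Ring R] {M N : Type} [AddCommGroup M] [Module R M]
    [AddCommGroup N] [Module R N] (I : Ideal R) (f : M →ₗ[R] N) (K : Submodule R M) :
    Submodule.map f (jSMul I K) = jSMul I (Submodule.map f K) := by
  rw [jSMul, jSMul, Submodule.map_span]
  congr 1
  ext x
  constructor
  · rintro ⟨_, ⟨r, hr, k, hk, rfl⟩, rfl⟩
    exact ⟨r, hr, f k, Submodule.mem_map_of_mem hk, map_smul f r k⟩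
  · rintro ⟨r, hr, _, ⟨k, hk, rfl⟩, rfl⟩
    exact ⟨r • k, ⟨r, hr, k, hk, rfl⟩, map_smul f r k⟩

theorem jSMul_mono_right {R : Type} [Ring R] {M : Type} [AddCommGroup M] [Module R M]
    (I : Ideal R) {K L : Submodule R M} (h : K ≤ L) : jSMul I K ≤ jSMul I L :=
  Submodule.span_mono fun _ ⟨r, hr, k, hk, hx⟩ => ⟨r, hr, k, h hk, hx⟩

theorem apply_mem_jSMul_top {R : Type} [Ring R] {M N : Type} [AddCommGroup M] [Module R M]
    [AddCommGroup N] [Module R N] {I : Ideal R} (f : M →ₗ[R] N) {x : M}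
    (hx : x ∈ jSMul I (⊤ : Submodule R M)) : f x ∈ jSMul I (⊤ : Submodule R N) := by
  have h := Submodule.mem_map_of_mem (f := f) hx
  rw [map_jSMul] at h
  exact jSMul_mono_right I le_top h

/-- If `ker f ⊆ I·M` and `f` is surjective, then membership in `I·N` can be lifted along `f`. -/
theorem mem_jSMul_top_of_apply_mem {R : Type} [Ring R] {M N : Type} [AddCommGroup M] [Module R M]
    [AddCommGroup N] [Module R N] {I : Ideal R} {f : M →ₗ[R] N} (hf : Function.Surjective f)
    (hker : LinearMap.ker f ≤ jSMul I (⊤ : Submodule R M)) {x : M}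
    (hx : f x ∈ jSMul I (⊤ : Submodule R N)) : x ∈ jSMul I (⊤ : Submodule R M) := by
  rw [← LinearMap.range_eq_top.mpr hf, LinearMap.range_eq_map, ← map_jSMul] at hx
  obtain ⟨y, hy, hyx⟩ := hx
  have hxy : x - y ∈ LinearMap.ker f := by simp [hyx]
  simpa using add_mem (hker hxy) hy

/-- the minimal Horseshoe construction in degree zero. -/
theorem minimal_horseshoe_step {R : Type} [Ring R] (J : Ideal R)
    (hJ : J = jacobsonRad R)
    {K M N : Type} [AddCommGroup K] [Module R K] [AddCommGroup M] [Module R M]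
    [AddCommGroup N] [Module R N]
    [Module.Finite R K] [Module.Finite R M] [Module.Finite R N]
    (f : K →ₗ[R] M) (g : M →ₗ[R] N)
    (hf : Function.Injective f) (hg : Function.Surjective g)
    (hfg : LinearMap.range f = LinearMap.ker g)
    (hJK : Submodule.map f (jSMul J (⊤ : Submodule R K)) =
      LinearMap.range f ⊓ jSMul J (⊤ : Submodule R M))
    {P Q : Type} [AddCommGroup P] [Module R P] [AddCommGroup Q] [Module R Q]
    (hPproj : Module.Projective R P) (hPfin : Module.Finite R P)
    (hQproj : Module.Projective R Q) (hQfin : Module.Finite R Q)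
    (p : P →ₗ[R] K) (hp : Function.Surjective p)
    (hpker : LinearMap.ker p ≤ jSMul J (⊤ : Submodule R P))
    (q : Q →ₗ[R] N) (hq : Function.Surjective q)
    (hqker : LinearMap.ker q ≤ jSMul J (⊤ : Submodule R Q)) :
    ∃ l : P × Q →ₗ[R] M,
      l ∘ₗ LinearMap.inl R P Q = f ∘ₗ p ∧
      g ∘ₗ l = q ∘ₗ LinearMap.snd R P Q ∧
      Function.Surjective l ∧
      LinearMap.ker l ≤ jSMul J (⊤ : Submodule R (P × Q)) ∧
      Submodule.map (LinearMap.inl R P Q) (LinearMap.ker p) =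
        LinearMap.ker l ⊓ LinearMap.ker (LinearMap.snd R P Q) ∧
      Submodule.map (LinearMap.snd R P Q) (LinearMap.ker l) =
        LinearMap.ker q := by
  obtain ⟨s, hs⟩ := Module.projective_lifting_property g q hg
  have hgs (y : Q) : g (s y) = q y := LinearMap.congr_fun hs y
  have hgf (k : K) : g (f k) = 0 := by
    have : f k ∈ LinearMap.ker g := hfg ▸ LinearMap.mem_range_self f k
    exact this
  have hlift (m : M) (hm : g m = 0) : ∃ x, f (p x) = m := by
    have hm' : m ∈ LinearMap.range f := by rw [hfg]; exact hm
    obtain ⟨k, rfl⟩ := hm'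
    obtain ⟨x, rfl⟩ := hp k
    exact ⟨x, rfl⟩
  have hker (z : P × Q) (hz : (f ∘ₗ p).coprod s z = 0) : q z.2 = 0 := by
    simpa [hgf, hgs] using congrArg g hz
  refine ⟨(f ∘ₗ p).coprod s, LinearMap.coprod_inl _ _, ?_, ?_, ?_, ?_, ?_⟩
  · ext z <;> simp [hgf, hgs]
  · intro m
    obtain ⟨y, hy⟩ := hq (g m)
    obtain ⟨x, hx⟩ := hlift (m - s y) (by simp [hgs, hy])
    exact ⟨(x, y), by simp [hx]⟩
  · rintro ⟨x, y⟩ hz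
    have hy : y ∈ jSMul J (⊤ : Submodule R Q) := hqker (hker _ hz)
    have hxy : f (p x) = -s y := eq_neg_of_add_eq_zero_left (by simpa using hz)
    have hfx : f (p x) ∈ Submodule.map f (jSMul J (⊤ : Submodule R K)) := by
      rw [hJK]
      exact ⟨LinearMap.mem_range_self f _, hxy ▸ neg_mem (apply_mem_jSMul_top s hy)⟩
    have hx : x ∈ jSMul J (⊤ : Submodule R P) :=
      mem_jSMul_top_of_apply_mem hp hpker ((Function.Injective.mem_set_image hf).mp hfx)
    simpa using add_mem (apply_mem_jSMul_top (LinearMap.inl R P Q) hx)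
      (apply_mem_jSMul_top (LinearMap.inr R P Q) hy)
  · ext ⟨x, y⟩
    constructor
    · rintro ⟨x', hx', h⟩
      obtain ⟨rfl, rfl⟩ := Prod.mk.inj h
      simp [LinearMap.mem_ker.mp hx']
    · rintro ⟨hl, hy⟩
      obtain rfl : y = 0 := hy
      have hfx : f (p x) = 0 := by simpa using hl
      exact ⟨x, hf (hfx.trans (map_zero f).symm), rfl⟩
  · ext y
    constructor
    · rintro ⟨z, hz, rfl⟩
      exact hker z hz
    · intro hy
      obtain ⟨x, hx⟩ := hlift (s y) ((hgs y).trans hy)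
      exact ⟨(-x, y), by simp [hx], rfl⟩
end

section
/- Let R be a Noetherian semiperfect ring with Jacobson radical J and let ξ : 0 → K → M → N → 0 be a short exact sequence of finitely generated R-modules. Then the minimal Horseshoe Lemma holds for ξ if and only if there exist minimal projective resolutions P_• → K and L_• → M together with an injective chain map P_• → L_• lifting the inclusion K → M, such that for every i ≥ 0 the induced embedding of syzygies Ω^i(K) ↪ Ω^i(M) satisfies J·Ω^i(K) = Ω^i(K) ∩ J·Ω^i(M). -/
section Radical

variable {R : Type} [Ring R] {A B C D : Type}
  [AddCommGroup A] [Module R A] [AddCommGroup B] [Module R B]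
  [AddCommGroup C] [Module R C] [AddCommGroup D] [Module R D]

theorem jSMul_eq_smul (I : Ideal R) (S : Submodule R A) : jSMul I S = I • S := by
  refine le_antisymm (Submodule.span_le.2 ?_) (Submodule.smul_le.2 fun r hr k hk =>
    Submodule.subset_span ⟨r, hr, k, hk, rfl⟩)
  rintro _ ⟨r, hr, k, hk, rfl⟩
  exact Submodule.smul_mem_smul hr hk

/-- Nakayama's lemma over a noncommutative ring, relative to a submodule `T`. -/
theorem Submodule.FG.le_of_le_sup_jacobson_smul {S T : Submodule R A} (hS : S.FG)
    (h : S ≤ T ⊔ jacobsonRad R • S) : S ≤ T := by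
  have hmap : S.map T.mkQ = ⊥ := by
    refine (hS.map T.mkQ).eq_bot_of_le_jacobson_smul ?_
    rw [← Ideal.jacobson_bot, ← Submodule.map_smul'']
    refine (Submodule.map_mono h).trans ?_
    simp [Submodule.map_sup]
  rw [← T.ker_mkQ]
  exact LinearMap.le_ker_iff_map.2 hmap

theorem comap_smul_range_of_ker_le {I : Ideal R} {α : A →ₗ[R] B}
    (hα : LinearMap.ker α ≤ I • ⊤) : (I • LinearMap.range α).comap α = I • ⊤ := by
  rw [LinearMap.range_eq_map, ← Submodule.map_smul'', Submodule.comap_map_eq_self hα]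

/-- In a commutative square `α`, `β` of projective covers over an injection `φ`, the images satisfy
`J·im α = im α ∩ J·im β` exactly when `φ'` is injective modulo `J`. -/
theorem map_smul_range_eq_inf_iff {I : Ideal R} {α : A →ₗ[R] C} {β : B →ₗ[R] D}
    {φ' : A →ₗ[R] B} {φ : C →ₗ[R] D} (hα : LinearMap.ker α ≤ I • ⊤)
    (hβ : LinearMap.ker β ≤ I • ⊤) (hφ : Function.Injective φ) (hcomm : β ∘ₗ φ' = φ ∘ₗ α) :
    (I • LinearMap.range α).map φ =
        (LinearMap.range α).map φ ⊓ I • LinearMap.range β ↔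
      (I • (⊤ : Submodule R B)).comap φ' ≤ I • ⊤ := by
  have hc : ∀ a, β (φ' a) = φ (α a) := LinearMap.congr_fun hcomm
  have hα' : ∀ a, α a ∈ I • LinearMap.range α ↔ a ∈ I • (⊤ : Submodule R A) := fun a =>
    SetLike.ext_iff.1 (comap_smul_range_of_ker_le hα) a
  have hβ' : ∀ b, β b ∈ I • LinearMap.range β ↔ b ∈ I • (⊤ : Submodule R B) := fun b =>
    SetLike.ext_iff.1 (comap_smul_range_of_ker_le hβ) b
  constructor
  · intro h a ha
    have hmem : φ (α a) ∈ (I • LinearMap.range α).map φ := by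
      rw [h]
      exact ⟨⟨_, ⟨a, rfl⟩, rfl⟩, hc a ▸ (hβ' _).2 ha⟩
    obtain ⟨y, hy, hya⟩ := hmem
    exact (hα' a).1 (hφ hya ▸ hy)
  · intro h
    refine le_antisymm (le_inf (Submodule.map_mono Submodule.smul_le_right) ?_) ?_
    · rw [Submodule.map_smul'']
      refine Submodule.smul_mono le_rfl ?_
      rintro _ ⟨_, ⟨a, rfl⟩, rfl⟩
      exact ⟨φ' a, hc a⟩
    · rintro _ ⟨⟨_, ⟨a, rfl⟩, rfl⟩, ha⟩
      exact ⟨α a, (hα' a).2 (h ((hβ' _).1 (hc a ▸ ha))), rfl⟩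

/-- If an injection `φ` has a projective cokernel, then it is injective modulo every ideal. -/
theorem comap_smul_top_le_of_split {I : Ideal R} [Module.Projective R C]
    {φ : A →ₗ[R] B} {ψ : B →ₗ[R] C} (hφ : Function.Injective φ) (hψ : Function.Surjective ψ)
    (h : LinearMap.ker ψ = LinearMap.range φ) :
    (I • (⊤ : Submodule R B)).comap φ ≤ I • ⊤ := by
  obtain ⟨s, hs⟩ := ψ.exists_rightInverse_of_surjective (LinearMap.range_eq_top.2 hψ)
  have hex : Function.Exact φ ψ := LinearMap.exact_iff.2 h
  have hsplit := (hex.split_tfae hφ hψ).out 0 1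
  obtain ⟨r, hr⟩ := hsplit.1 ⟨s, hs⟩
  intro a ha
  have hmem := Submodule.mem_map_of_mem (f := r) (Submodule.mem_comap.1 ha)
  rw [Submodule.map_smul'', show r (φ a) = a from LinearMap.congr_fun hr a] at hmem
  exact Submodule.smul_mono le_rfl le_top hmem

theorem mk_mem_smul_top {I : Ideal R} {S : Submodule R A} {x y : A} (hy : y ∈ S)
    (h : x - y ∈ I • (⊤ : Submodule R A)) :
    (Submodule.Quotient.mk x : A ⧸ S) ∈ I • (⊤ : Submodule R (A ⧸ S)) := by
  have hmem := Submodule.mem_map_of_mem (f := S.mkQ) h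
  rw [Submodule.map_smul''] at hmem
  rw [(Submodule.Quotient.eq S).2 (show x - (x - y) ∈ S by rwa [sub_sub_cancel])]
  exact Submodule.smul_mono le_rfl le_top hmem

/-- Over a semiperfect ring, a map of finitely generated projective modules that is injective modulo
the radical has a projective cokernel. -/
theorem Semiperfect.projective_quotient_range (hsp : Semiperfect R)
    [Module.Finite R A] [Module.Finite R B] [Module.Projective R B] {φ : A →ₗ[R] B}
    (h : (jacobsonRad R • (⊤ : Submodule R B)).comap φ ≤ jacobsonRad R • ⊤) :
    Module.Projective R (B ⧸ LinearMap.range φ) := by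
  obtain ⟨c⟩ := hsp (B ⧸ LinearMap.range φ) inferInstance
  have := c.proj
  have := c.fin
  have hker := c.ker_le
  rw [jSMul_eq_smul] at hker
  obtain ⟨q, hq⟩ := Module.projective_lifting_property c.p (LinearMap.range φ).mkQ c.surj
  have hq' : ∀ b, c.p (q b) = (LinearMap.range φ).mkQ b := LinearMap.congr_fun hq
  have hqsurj : Function.Surjective q := by
    rw [← LinearMap.range_eq_top, ← top_le_iff]
    refine Module.Finite.fg_top.le_of_le_sup_jacobson_smul fun x _ => ?_
    obtain ⟨b, hb⟩ := (LinearMap.range φ).mkQ_surjective (c.p x)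
    rw [← hq', ← sub_eq_zero, ← map_sub, ← LinearMap.mem_ker] at hb
    rw [← sub_sub_cancel (q b) x]
    exact Submodule.sub_mem _ (Submodule.mem_sup_left ⟨b, rfl⟩) (Submodule.mem_sup_right (hker hb))
  obtain ⟨s, hs⟩ := q.exists_rightInverse_of_surjective (LinearMap.range_eq_top.2 hqsurj)
  have hs' : ∀ x, q (s x) = x := LinearMap.congr_fun hs
  have hle : LinearMap.ker q ≤ LinearMap.range φ := fun b hb => by
    rw [← (LinearMap.range φ).ker_mkQ, LinearMap.mem_ker, ← hq', LinearMap.mem_ker.1 hb, map_zero]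
  have hge : LinearMap.range φ ≤ LinearMap.ker q := by
    have hfgr : (LinearMap.range φ).FG := by
      rw [LinearMap.range_eq_map]
      exact Module.Finite.fg_top.map φ
    refine hfgr.le_of_le_sup_jacobson_smul fun b hb => ?_
    have hdiff : b - s (q b) ∈ LinearMap.ker q := by simp [hs']
    obtain ⟨a, ha⟩ : s (q b) ∈ LinearMap.range φ := by
      rw [← sub_sub_cancel b (s (q b))]
      exact Submodule.sub_mem _ hb (hle hdiff)
    have hqb : q b ∈ LinearMap.ker c.p := by
      rwa [LinearMap.mem_ker, hq', ← LinearMap.mem_ker, Submodule.ker_mkQ]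
    have hsq : s (q b) ∈ jacobsonRad R • (⊤ : Submodule R B) := by
      have hmem := Submodule.mem_map_of_mem (f := s) (hker hqb)
      rw [Submodule.map_smul''] at hmem
      exact Submodule.smul_mono le_rfl le_top hmem
    have haJ : a ∈ jacobsonRad R • (⊤ : Submodule R A) := h (Submodule.mem_comap.2 (ha.symm ▸ hsq))
    have hmem := Submodule.mem_map_of_mem (f := φ) haJ
    rw [Submodule.map_smul'', ← LinearMap.range_eq_map, ha] at hmem
    rw [← sub_add_cancel b (s (q b))]
    exact Submodule.add_mem _ (Submodule.mem_sup_left hdiff) (Submodule.mem_sup_right hmem)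
  exact Module.Projective.of_equiv
    ((Submodule.quotEquivOfEq _ _ (le_antisymm hle hge)).symm.trans
      (q.quotKerEquivOfSurjective hqsurj)).symm

end Radical

section Quotient

variable {R : Type} [Ring R] {J : Ideal R} {K M N : Type} [AddCommGroup K] [Module R K]
  [AddCommGroup M] [Module R M] [AddCommGroup N] [Module R N]
  {f : K →ₗ[R] M} {g : M →ₗ[R] N} {P : MinProjRes R J K} {L : MinProjRes R J M}
  {φ : ∀ n, P.obj n →ₗ[R] L.obj n}

namespace MinProjRes

theorem range_d (P : MinProjRes R J K) (n : ℕ) : LinearMap.range (P.d n) = P.syz n := by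
  cases n
  exacts [P.exact0, P.exact _]

theorem ker_aug_le (P : MinProjRes R J K) : LinearMap.ker P.aug ≤ J • ⊤ :=
  jSMul_eq_smul J (⊤ : Submodule R (P.obj 0)) ▸ P.minimal0

theorem ker_d_le (P : MinProjRes R J K) (n : ℕ) : LinearMap.ker (P.d n) ≤ J • ⊤ :=
  jSMul_eq_smul J (⊤ : Submodule R (P.obj (n + 1))) ▸ P.minimal n

theorem range_aug (P : MinProjRes R J K) : LinearMap.range P.aug = ⊤ :=
  LinearMap.range_eq_top.2 P.aug_surj

theorem d_mem_syz (P : MinProjRes R J K) (n : ℕ) (x : P.obj (n + 1)) : P.d n x ∈ P.syz n :=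
  P.range_d n ▸ ⟨x, rfl⟩

end MinProjRes

theorem mem_syz_of_map_mem_syz (hf : Function.Injective f)
    (h0 : L.aug ∘ₗ φ 0 = f ∘ₗ P.aug) (hd : ∀ n, L.d n ∘ₗ φ (n + 1) = φ n ∘ₗ P.d n)
    (hφ : ∀ n, Function.Injective (φ n)) (n : ℕ) {p : P.obj n} (hp : φ n p ∈ L.syz n) :
    p ∈ P.syz n := by
  cases n with
  | zero => exact hf (by simpa using (LinearMap.congr_fun h0 p).symm.trans hp)
  | succ n => exact hφ n (by simpa using (LinearMap.congr_fun (hd n) p).symm.trans hp)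

/-- A lift to `L` of a cycle of the quotient complex can be corrected to a cycle of `L`. -/
theorem exists_sub_mem_ker_d (hf : Function.Injective f)
    (h0 : L.aug ∘ₗ φ 0 = f ∘ₗ P.aug) (hd : ∀ n, L.d n ∘ₗ φ (n + 1) = φ n ∘ₗ P.d n)
    (hφ : ∀ n, Function.Injective (φ n)) (n : ℕ) {l : L.obj (n + 1)}
    (hl : L.d n l ∈ LinearMap.range (φ n)) :
    ∃ p, l - φ (n + 1) p ∈ LinearMap.ker (L.d n) := by
  obtain ⟨p, hp⟩ := hl
  have hps := mem_syz_of_map_mem_syz hf h0 hd hφ n (hp ▸ L.d_mem_syz n l)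
  rw [← P.range_d] at hps
  obtain ⟨p', rfl⟩ := hps
  refine ⟨p', ?_⟩
  have hc : L.d n (φ (n + 1) p') = φ n (P.d n p') := LinearMap.congr_fun (hd n) p'
  rw [LinearMap.mem_ker, map_sub, hc, hp, sub_self]

theorem exists_sub_mem_ker_aug (hfg : LinearMap.range f = LinearMap.ker g)
    (h0 : L.aug ∘ₗ φ 0 = f ∘ₗ P.aug) {l : L.obj 0} (hl : g (L.aug l) = 0) :
    ∃ p, l - φ 0 p ∈ LinearMap.ker L.aug := by
  obtain ⟨k, hk⟩ := hfg.ge hl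
  obtain ⟨p, rfl⟩ := P.aug_surj k
  refine ⟨p, ?_⟩
  have hc : L.aug (φ 0 p) = f (P.aug p) := LinearMap.congr_fun h0 p
  rw [LinearMap.mem_ker, map_sub, hc, hk, sub_self]

/-- The quotient of an inclusion of minimal projective resolutions is a minimal projective
resolution as soon as its terms are projective. -/
def MinProjRes.quotient (hf : Function.Injective f) (hg : Function.Surjective g)
    (hfg : LinearMap.range f = LinearMap.ker g)
    (h0 : L.aug ∘ₗ φ 0 = f ∘ₗ P.aug) (hd : ∀ n, L.d n ∘ₗ φ (n + 1) = φ n ∘ₗ P.d n)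
    (hφ : ∀ n, Function.Injective (φ n))
    (hproj : ∀ n, Module.Projective R (L.obj n ⧸ LinearMap.range (φ n))) :
    MinProjRes R J N where
  obj n := L.obj n ⧸ LinearMap.range (φ n)
  proj := hproj
  fin n := have := L.fin n; inferInstance
  d n := (LinearMap.range (φ (n + 1))).mapQ (LinearMap.range (φ n)) (L.d n) <| by
    rintro _ ⟨p, rfl⟩
    exact ⟨P.d n p, (LinearMap.congr_fun (hd n) p).symm⟩
  aug := (LinearMap.range (φ 0)).liftQ (g ∘ₗ L.aug) <| by
    rintro _ ⟨p, rfl⟩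
    have hc : L.aug (φ 0 p) = f (P.aug p) := LinearMap.congr_fun h0 p
    rw [LinearMap.mem_ker, LinearMap.comp_apply, hc]
    exact hfg.le ⟨_, rfl⟩
  aug_surj x := by
    obtain ⟨l, rfl⟩ := (hg.comp L.aug_surj) x
    exact ⟨Submodule.Quotient.mk l, rfl⟩
  exact0 := by
    ext x
    obtain ⟨l, rfl⟩ := Submodule.Quotient.mk_surjective _ x
    constructor
    · rintro ⟨y, hy⟩
      obtain ⟨m, rfl⟩ := Submodule.Quotient.mk_surjective _ y
      rw [← hy]
      have hm : L.aug (L.d 0 m) = 0 := L.d_mem_syz 0 m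
      change g (L.aug (L.d 0 m)) = 0
      rw [hm, map_zero]
    · intro hl
      obtain ⟨p, hp⟩ := exists_sub_mem_ker_aug hfg h0 hl
      rw [← L.exact0] at hp
      obtain ⟨m, hm⟩ := hp
      refine ⟨Submodule.Quotient.mk m, ?_⟩
      rw [Submodule.mapQ_apply, hm]
      exact (Submodule.Quotient.eq _).2 ⟨-p, by simp⟩
  exact n := by
    ext x
    obtain ⟨l, rfl⟩ := Submodule.Quotient.mk_surjective _ x
    constructor
    · rintro ⟨y, hy⟩
      obtain ⟨m, rfl⟩ := Submodule.Quotient.mk_surjective _ y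
      rw [← hy]
      have hm : L.d n (L.d (n + 1) m) = 0 := L.d_mem_syz (n + 1) m
      rw [LinearMap.mem_ker, Submodule.mapQ_apply, Submodule.mapQ_apply, hm,
        Submodule.Quotient.mk_zero]
    · intro hl
      rw [LinearMap.mem_ker, Submodule.mapQ_apply, Submodule.Quotient.mk_eq_zero] at hl
      obtain ⟨p, hp⟩ := exists_sub_mem_ker_d hf h0 hd hφ n hl
      rw [← L.exact] at hp
      obtain ⟨m, hm⟩ := hp
      refine ⟨Submodule.Quotient.mk m, ?_⟩
      rw [Submodule.mapQ_apply, hm]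
      exact (Submodule.Quotient.eq _).2 ⟨-p, by simp⟩
  minimal0 x hx := by
    obtain ⟨l, rfl⟩ := Submodule.Quotient.mk_surjective _ x
    obtain ⟨p, hp⟩ := exists_sub_mem_ker_aug hfg h0 hx
    rw [jSMul_eq_smul]
    exact mk_mem_smul_top ⟨p, rfl⟩ (L.ker_aug_le hp)
  minimal n x hx := by
    obtain ⟨l, rfl⟩ := Submodule.Quotient.mk_surjective _ x
    rw [LinearMap.mem_ker, Submodule.mapQ_apply, Submodule.Quotient.mk_eq_zero] at hx
    obtain ⟨p, hp⟩ := exists_sub_mem_ker_d hf h0 hd hφ n hx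
    rw [jSMul_eq_smul]
    exact mk_mem_smul_top ⟨p, rfl⟩ (L.ker_d_le n hp)

end Quotient

/-- the minimal Horseshoe Lemma holds for `ξ` iff there are minimal
projective resolutions of `K` and `M` with an injective chain map lifting
`K → M` such that `J·Ω^i(K) = Ω^i(K) ∩ J·Ω^i(M)` for all `i ≥ 0`. -/
theorem minimalHorseshoe_iff_syzygy_condition {R : Type} [Ring R]
    [IsNoetherianRing R] (hsp : Semiperfect R) (J : Ideal R)
    (hJ : J = jacobsonRad R)
    {K M N : Type} [AddCommGroup K] [Module R K] [AddCommGroup M] [Module R M]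
    [AddCommGroup N] [Module R N]
    [Module.Finite R K] [Module.Finite R M] [Module.Finite R N]
    (f : K →ₗ[R] M) (g : M →ₗ[R] N)
    (hf : Function.Injective f) (hg : Function.Surjective g)
    (hfg : LinearMap.range f = LinearMap.ker g) :
    MinimalHorseshoe J f g ↔
      ∃ (P : MinProjRes R J K) (L : MinProjRes R J M)
        (φ : ∀ n, P.obj n →ₗ[R] L.obj n),
        L.aug ∘ₗ φ 0 = f ∘ₗ P.aug ∧
        (∀ n, L.d n ∘ₗ φ (n + 1) = φ n ∘ₗ P.d n) ∧
        (∀ n, Function.Injective (φ n)) ∧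
        -- the case `i = 0`: `Ω⁰(K) = K ↪ M = Ω⁰(M)`
        Submodule.map f (jSMul J (⊤ : Submodule R K)) =
          LinearMap.range f ⊓ jSMul J (⊤ : Submodule R M) ∧
        -- the cases `i ≥ 1`: `Ω^{i+1}(K) = P.syz i ↪ L.syz i = Ω^{i+1}(M)`
        ∀ i, Submodule.map (φ i) (jSMul J (P.syz i)) =
          Submodule.map (φ i) (P.syz i) ⊓ jSMul J (L.syz i) := by
  subst hJ
  simp only [jSMul_eq_smul]
  constructor
  · rintro ⟨P, L, Q, φ, ψ, h0, -, hd, -, hφ, hψ, hex⟩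
    have hcomap : ∀ n, (jacobsonRad R • (⊤ : Submodule R (L.obj n))).comap (φ n) ≤
        jacobsonRad R • ⊤ := fun n =>
      have := Q.proj n
      comap_smul_top_le_of_split (hφ n) (hψ n) (hex n)
    refine ⟨P, L, φ, h0, hd, hφ, ?_, fun n => ?_⟩
    · have key := (map_smul_range_eq_inf_iff P.ker_aug_le L.ker_aug_le hf h0).2 (hcomap 0)
      rwa [P.range_aug, L.range_aug, ← LinearMap.range_eq_map] at key
    · have key := (map_smul_range_eq_inf_iff (P.ker_d_le n) (L.ker_d_le n) (hφ n) (hd n)).2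
        (hcomap (n + 1))
      rwa [P.range_d, L.range_d] at key
  · rintro ⟨P, L, φ, h0, hd, hφ, hcond0, hcond⟩
    have hcomap : ∀ n, (jacobsonRad R • (⊤ : Submodule R (L.obj n))).comap (φ n) ≤
        jacobsonRad R • ⊤ := by
      rintro (_ | n)
      · refine (map_smul_range_eq_inf_iff P.ker_aug_le L.ker_aug_le hf h0).1 ?_
        rwa [P.range_aug, L.range_aug, ← LinearMap.range_eq_map]
      · refine (map_smul_range_eq_inf_iff (P.ker_d_le n) (L.ker_d_le n) (hφ n) (hd n)).1 ?_
        rw [P.range_d, L.range_d]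
        exact hcond n
    have hproj : ∀ n, Module.Projective R (L.obj n ⧸ LinearMap.range (φ n)) := fun n =>
      have := P.fin n
      have := L.fin n
      have := L.proj n
      hsp.projective_quotient_range (hcomap n)
    exact ⟨P, L, MinProjRes.quotient hf hg hfg h0 hd hφ hproj, φ,
      fun n => (LinearMap.range (φ n)).mkQ, h0, rfl, hd, fun _ => rfl, hφ,
      fun n => Submodule.mkQ_surjective _, fun n => Submodule.ker_mkQ _⟩
end

section
/- Let R be an augmented Noetherian semiperfect algebra with Jacobson radical J and let ξ : 0 → K → M → N → 0 be a short exact sequence of finitely generated R-modules in which K, M and N are all quasi-δ-Koszul modules for a fixed strictly increasing set function δ : ℕ → ℕ. Then J·K = K ∩ J·M (identifying K with its image in M) if and only if the minimal Horseshoe Lemma holds for ξ. -/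
section JSMul

variable {R : Type} [Ring R] {J : Ideal R} {M N : Type} [AddCommGroup M] [Module R M]
  [AddCommGroup N] [Module R N]

theorem jSMul_mono {S T : Submodule R M} (h : S ≤ T) : jSMul J S ≤ jSMul J T :=
  Submodule.span_mono fun _ ⟨r, hr, m, hm, hx⟩ => ⟨r, hr, m, h hm, hx⟩

theorem map_jSMul_s5 (u : M →ₗ[R] N) (S : Submodule R M) :
    (jSMul J S).map u = jSMul J (S.map u) := by
  rw [jSMul, jSMul, Submodule.map_span]
  congr 1
  ext y
  constructor
  · rintro ⟨_, ⟨r, hr, m, hm, rfl⟩, rfl⟩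
    exact ⟨r, hr, u m, ⟨m, hm, rfl⟩, u.map_smul r m⟩
  · rintro ⟨r, hr, _, ⟨m, hm, rfl⟩, rfl⟩
    exact ⟨r • m, ⟨r, hr, m, hm, rfl⟩, u.map_smul r m⟩

theorem map_mem_jSMul_top (u : M →ₗ[R] N) {x : M} (hx : x ∈ jSMul J (⊤ : Submodule R M)) :
    u x ∈ jSMul J (⊤ : Submodule R N) := by
  have := Submodule.mem_map_of_mem (f := u) hx
  rw [map_jSMul_s5] at this
  exact jSMul_mono le_top this

theorem exists_mem_jSMul_top_of_surjective {u : M →ₗ[R] N} (hu : Function.Surjective u) {y : N}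
    (hy : y ∈ jSMul J (⊤ : Submodule R N)) : ∃ x ∈ jSMul J (⊤ : Submodule R M), u x = y := by
  rw [← LinearMap.range_eq_top.2 hu, ← Submodule.map_top, ← map_jSMul_s5] at hy
  exact hy

theorem mem_jSMul_top_coe_iff (S : Submodule R M) (x : S) :
    x ∈ jSMul J (⊤ : Submodule R S) ↔ (x : M) ∈ jSMul J S := by
  have h : (jSMul J (⊤ : Submodule R S)).map S.subtype = jSMul J S := by
    rw [map_jSMul_s5, Submodule.map_top, Submodule.range_subtype]
  rw [← h]
  simp

theorem jPowSMul_mono (n : ℕ) {S T : Submodule R M} (h : S ≤ T) :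
    jPowSMul J n S ≤ jPowSMul J n T := by
  induction n with
  | zero => exact h
  | succ n ih => exact jSMul_mono ih

theorem map_jPowSMul (u : M →ₗ[R] N) (n : ℕ) (S : Submodule R M) :
    (jPowSMul J n S).map u = jPowSMul J n (S.map u) := by
  induction n with
  | zero => rfl
  | succ n ih => rw [jPowSMul, jPowSMul, map_jSMul_s5, ih]

theorem map_mem_jPowSMul_top (u : M →ₗ[R] N) (n : ℕ) {x : M}
    (hx : x ∈ jPowSMul J n (⊤ : Submodule R M)) : u x ∈ jPowSMul J n (⊤ : Submodule R N) := by
  have := Submodule.mem_map_of_mem (f := u) hx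
  rw [map_jPowSMul] at this
  exact jPowSMul_mono n le_top this

theorem mem_jSMul_top_of_map {u : M →ₗ[R] N} (hu : Function.Surjective u)
    (hker : LinearMap.ker u ≤ jSMul J ⊤) {x : M} (hx : u x ∈ jSMul J (⊤ : Submodule R N)) :
    x ∈ jSMul J (⊤ : Submodule R M) := by
  obtain ⟨y, hy, hyx⟩ := exists_mem_jSMul_top_of_surjective hu hx
  have := Submodule.add_mem _ (hker (x := x - y) (by simp [hyx])) hy
  simpa using this

/-- Nakayama's lemma in the form of supplements. -/
theorem eq_top_of_sup_jSMul_eq_top [Module.Finite R M] (hJ : J ≤ jacobsonRad R)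
    {S : Submodule R M} (h : S ⊔ jSMul J ⊤ = ⊤) : S = ⊤ := by
  refine (eq_top_or_exists_le_coatom S).resolve_right ?_
  rintro ⟨m, hm, hS⟩
  refine hm.1 (top_le_iff.1 (h ▸ sup_le hS (Submodule.span_le.2 ?_)))
  rintro _ ⟨r, hr, x, -, rfl⟩
  have hr' : r ∈ Ring.jacobson R := Ideal.jacobson_bot (R := R) ▸ hJ hr
  have hx : r • x ∈ Module.jacobson R M :=
    Module.le_comap_jacobson (LinearMap.toSpanSingleton R M x) hr'
  exact Submodule.mem_sInf.1 hx m hm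

variable {X : Type} [AddCommGroup X] [Module R X]

theorem surjective_of_comp_projCover [Module.Finite R N] (hJ : J ≤ jacobsonRad R)
    {p : M →ₗ[R] X} {q : N →ₗ[R] X} (hp : Function.Surjective p)
    (hker : LinearMap.ker q ≤ jSMul J ⊤) {u : M →ₗ[R] N} (hu : q ∘ₗ u = p) :
    Function.Surjective u := by
  rw [← LinearMap.range_eq_top]
  refine eq_top_of_sup_jSMul_eq_top hJ (top_le_iff.1 fun y _ => ?_)
  obtain ⟨x, hx⟩ := hp (q y)
  rw [← hu] at hx
  rw [← add_sub_cancel (u x) y]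
  exact Submodule.add_mem_sup ⟨x, rfl⟩ (hker (by simpa [sub_eq_zero] using hx.symm))

/-- Projective covers are unique up to isomorphism. -/
theorem exists_equiv_of_projCovers [Module.Finite R M] [Module.Finite R N]
    [Module.Projective R M] [Module.Projective R N] (hJ : J ≤ jacobsonRad R)
    {p : M →ₗ[R] X} {q : N →ₗ[R] X} (hp : Function.Surjective p) (hq : Function.Surjective q)
    (hpk : LinearMap.ker p ≤ jSMul J ⊤) (hqk : LinearMap.ker q ≤ jSMul J ⊤) :
    ∃ e : M ≃ₗ[R] N, ∀ x, q (e x) = p x := by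
  obtain ⟨u, hu⟩ := Module.projective_lifting_property q p hq
  have hus := surjective_of_comp_projCover hJ hp hqk hu
  obtain ⟨s, hs⟩ := Module.projective_lifting_property u LinearMap.id hus
  have hss : Function.Surjective s :=
    surjective_of_comp_projCover hJ hq hpk
      (by rw [← hu, LinearMap.comp_assoc, hs, LinearMap.comp_id])
  have hui : Function.Injective u := fun a b hab => by
    obtain ⟨a, rfl⟩ := hss a
    obtain ⟨b, rfl⟩ := hss b
    have h : ∀ c, u (s c) = c := LinearMap.congr_fun hs
    rw [h, h] at hab
    rw [hab]
  exact ⟨LinearEquiv.ofBijective u ⟨hui, hus⟩, LinearMap.congr_fun hu⟩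

end JSMul

namespace MinProjRes

variable {R : Type} [Ring R] {J : Ideal R} {X : Type} [AddCommGroup X] [Module R X]

/-- The condition on a minimal projective resolution that exhibits a quasi-`δ`-Koszul module. -/
def IsDeltaKoszul (P : MinProjRes R J X) (δ : ℕ → ℕ) : Prop :=
  ∀ n, P.syz n ≤ jPowSMul J (δ (n + 1) - δ n) ⊤ ∧
    jSMul J (P.syz n) = P.syz n ⊓ jPowSMul J (δ (n + 1) - δ n + 1) ⊤

/-- The tail of a minimal projective resolution resolves the kernel of any map isomorphic to
the augmentation. -/
def tail (P : MinProjRes R J X) {L : Type} [AddCommGroup L] [Module R L] (p : L →ₗ[R] X)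
    (e : L ≃ₗ[R] P.obj 0) (he : ∀ x, P.aug (e x) = p x) :
    MinProjRes R J (LinearMap.ker p) where
  obj n := P.obj (n + 1)
  proj n := P.proj (n + 1)
  fin n := P.fin (n + 1)
  d n := P.d (n + 1)
  aug := (e.symm.toLinearMap ∘ₗ P.d 0).codRestrict _ fun x => by
    have : P.d 0 x ∈ LinearMap.ker P.aug := P.exact0 ▸ LinearMap.mem_range_self _ x
    simpa [← he] using this
  aug_surj := by
    rintro ⟨x, hx⟩
    have h : e x ∈ LinearMap.range (P.d 0) := by
      rw [P.exact0, LinearMap.mem_ker, he]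
      exact hx
    obtain ⟨y, hy⟩ := h
    exact ⟨y, Subtype.ext (by simp [hy])⟩
  exact0 := by
    rw [P.exact 0, LinearMap.ker_codRestrict, LinearEquiv.ker_comp]
  exact n := P.exact (n + 1)
  minimal0 := by
    rw [LinearMap.ker_codRestrict, LinearEquiv.ker_comp]
    exact P.minimal 0
  minimal n := P.minimal (n + 1)

theorem syz_tail (P : MinProjRes R J X) {L : Type} [AddCommGroup L] [Module R L] (p : L →ₗ[R] X)
    (e : L ≃ₗ[R] P.obj 0) (he : ∀ x, P.aug (e x) = p x) (n : ℕ) :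
    (P.tail p e he).syz n = P.syz (n + 1) := by
  cases n with
  | zero =>
    change LinearMap.ker (LinearMap.codRestrict _ _ _) = LinearMap.ker (P.d 0)
    rw [LinearMap.ker_codRestrict, LinearEquiv.ker_comp]
  | succ n => rfl

theorem IsDeltaKoszul.tail {P : MinProjRes R J X} {δ : ℕ → ℕ} (h : P.IsDeltaKoszul δ)
    {L : Type} [AddCommGroup L] [Module R L] (p : L →ₗ[R] X)
    (e : L ≃ₗ[R] P.obj 0) (he : ∀ x, P.aug (e x) = p x) :
    (P.tail p e he).IsDeltaKoszul fun n => δ (n + 1) := by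
  intro n
  rw [syz_tail]
  exact h (n + 1)

/-- The minimal projective resolution spliced from projective covers of successive syzygies. -/
def splice (X : ℕ → Type) [∀ n, AddCommGroup (X n)] [∀ n, Module R (X n)]
    (P : ℕ → Type) [∀ n, AddCommGroup (P n)] [∀ n, Module R (P n)]
    (proj : ∀ n, Module.Projective R (P n)) (fin : ∀ n, Module.Finite R (P n))
    (p : ∀ n, P n →ₗ[R] X n) (i : ∀ n, X (n + 1) →ₗ[R] P n)
    (hp : ∀ n, Function.Surjective (p n)) (hi : ∀ n, Function.Injective (i n))
    (hip : ∀ n, LinearMap.range (i n) = LinearMap.ker (p n))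
    (hker : ∀ n, LinearMap.ker (p n) ≤ jSMul J ⊤) : MinProjRes R J (X 0) where
  obj := P
  proj := proj
  fin := fin
  d n := i n ∘ₗ p (n + 1)
  aug := p 0
  aug_surj := hp 0
  exact0 := by
    rw [LinearMap.range_comp_of_range_eq_top _ (LinearMap.range_eq_top.2 (hp 1)), hip]
  exact n := by
    rw [LinearMap.range_comp_of_range_eq_top _ (LinearMap.range_eq_top.2 (hp (n + 2))), hip,
      LinearMap.ker_comp_of_ker_eq_bot _ (LinearMap.ker_eq_bot.2 (hi n))]
  minimal0 := hker 0
  minimal n := by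
    rw [LinearMap.ker_comp_of_ker_eq_bot _ (LinearMap.ker_eq_bot.2 (hi n))]
    exact hker (n + 1)

end MinProjRes

/-- Every projective cover of a quasi-`δ`-Koszul module computes its first syzygy. -/
theorem IsQuasiDeltaKoszul.of_projCover {R : Type} [Ring R] {J : Ideal R} (hJ : J ≤ jacobsonRad R)
    {δ : ℕ → ℕ} {X : Type} [AddCommGroup X] [Module R X] (h : IsQuasiDeltaKoszul J δ X)
    {L : Type} [AddCommGroup L] [Module R L] [Module.Projective R L] [Module.Finite R L]
    {p : L →ₗ[R] X} (hp : Function.Surjective p) (hker : LinearMap.ker p ≤ jSMul J ⊤) :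
    jSMul J (LinearMap.ker p) ≤ jPowSMul J (δ 1 - δ 0 + 1) ⊤ ∧
      IsQuasiDeltaKoszul J (fun n => δ (n + 1)) (LinearMap.ker p) := by
  obtain ⟨P, hP⟩ := h
  have := P.proj 0
  have := P.fin 0
  obtain ⟨e, he⟩ := exists_equiv_of_projCovers hJ hp P.aug_surj hker P.minimal0
  refine ⟨fun x hx => ?_, P.tail p e he, MinProjRes.IsDeltaKoszul.tail hP p e he⟩
  have hmap : (LinearMap.ker p).map e.toLinearMap ≤ LinearMap.ker P.aug := by
    rintro _ ⟨y, hy, rfl⟩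
    exact (he y).trans hy
  have hex := Submodule.mem_map_of_mem (f := e.toLinearMap) hx
  rw [map_jSMul_s5] at hex
  have hex' : e x ∈ jSMul J (P.syz 0) := jSMul_mono hmap hex
  rw [(hP 0).2] at hex'
  simpa using map_mem_jPowSMul_top e.symm.toLinearMap _ hex'.2

/-- A short exact sequence `0 → K → M → N → 0` with minimal projective resolutions of its ends,
subject to the conditions that persist on passing to syzygies. -/
structure HorseshoeDatum (R : Type) [Ring R] (J : Ideal R) where
  K : Type
  M : Type
  N : Type
  [addCommGroupK : AddCommGroup K]
  [addCommGroupM : AddCommGroup M]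
  [addCommGroupN : AddCommGroup N]
  [moduleK : Module R K]
  [moduleM : Module R M]
  [moduleN : Module R N]
  f : K →ₗ[R] M
  g : M →ₗ[R] N
  injective : Function.Injective f
  surjective : Function.Surjective g
  range_eq_ker : LinearMap.range f = LinearMap.ker g
  δ : ℕ → ℕ
  P : MinProjRes R J K
  Q : MinProjRes R J N
  koszul_P : P.IsDeltaKoszul δ
  koszul_M : IsQuasiDeltaKoszul J δ M
  mem_of_map_mem : ∀ x : K, f x ∈ jSMul J (⊤ : Submodule R M) → x ∈ jSMul J (⊤ : Submodule R K)

namespace HorseshoeDatum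

attribute [instance] addCommGroupK addCommGroupM addCommGroupN moduleK moduleM moduleN

variable {R : Type} [Ring R] {J : Ideal R} (D : HorseshoeDatum R J)

theorem exists_lift : ∃ h : D.Q.obj 0 →ₗ[R] D.M, D.g ∘ₗ h = D.Q.aug :=
  have := D.Q.proj 0
  Module.projective_lifting_property _ _ D.surjective

/-- A lift to the middle term of the projective cover of the right-hand term. -/
noncomputable def lift : D.Q.obj 0 →ₗ[R] D.M := D.exists_lift.choose

theorem g_lift (q : D.Q.obj 0) : D.g (D.lift q) = D.Q.aug q :=
  LinearMap.congr_fun D.exists_lift.choose_spec q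

/-- The projective cover of the middle term. -/
noncomputable def cover : D.P.obj 0 × D.Q.obj 0 →ₗ[R] D.M :=
  (D.f ∘ₗ D.P.aug).coprod D.lift

theorem cover_apply (x : D.P.obj 0 × D.Q.obj 0) : D.cover x = D.f (D.P.aug x.1) + D.lift x.2 :=
  rfl

theorem g_f (x : D.K) : D.g (D.f x) = 0 := by
  rw [← LinearMap.mem_ker, ← D.range_eq_ker]
  exact ⟨x, rfl⟩

theorem g_cover (x : D.P.obj 0 × D.Q.obj 0) : D.g (D.cover x) = D.Q.aug x.2 := by
  rw [cover_apply, map_add, g_f, g_lift, zero_add]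

theorem exists_cover_eq {q : D.Q.obj 0} {m : D.M} (h : D.Q.aug q = D.g m) :
    ∃ p, D.cover (p, q) = m := by
  have hm : m - D.lift q ∈ LinearMap.range D.f := by
    rw [D.range_eq_ker, LinearMap.mem_ker, map_sub, g_lift, h, sub_self]
  obtain ⟨x, hx⟩ := hm
  obtain ⟨p, rfl⟩ := D.P.aug_surj x
  exact ⟨p, by rw [cover_apply, hx, sub_add_cancel]⟩

theorem cover_surjective : Function.Surjective D.cover := fun m => by
  obtain ⟨q, hq⟩ := D.Q.aug_surj (D.g m)
  obtain ⟨p, hp⟩ := D.exists_cover_eq hq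
  exact ⟨_, hp⟩

theorem aug_snd_eq_zero {x : D.P.obj 0 × D.Q.obj 0} (hx : x ∈ LinearMap.ker D.cover) :
    D.Q.aug x.2 = 0 := by
  rw [← g_cover, LinearMap.mem_ker.1 hx, map_zero]

theorem ker_cover_le : LinearMap.ker D.cover ≤ jSMul J ⊤ := by
  rintro ⟨p, q⟩ hx
  have hq : q ∈ jSMul J (⊤ : Submodule R (D.Q.obj 0)) := D.Q.minimal0 (D.aug_snd_eq_zero hx)
  have hfp : D.f (D.P.aug p) = -D.lift q := eq_neg_of_add_eq_zero_left hx
  have hp : p ∈ jSMul J (⊤ : Submodule R (D.P.obj 0)) := by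
    refine mem_jSMul_top_of_map D.P.aug_surj D.P.minimal0 (D.mem_of_map_mem _ ?_)
    rw [hfp]
    exact Submodule.neg_mem _ (map_mem_jSMul_top _ hq)
  have := Submodule.add_mem _ (map_mem_jSMul_top (LinearMap.inl R _ (D.Q.obj 0)) hp)
    (map_mem_jSMul_top (LinearMap.inr R (D.P.obj 0) _) hq)
  simpa using this

theorem cover_projective : Module.Projective R (D.P.obj 0 × D.Q.obj 0) :=
  have := D.P.proj 0
  have := D.Q.proj 0
  inferInstance

theorem cover_finite : Module.Finite R (D.P.obj 0 × D.Q.obj 0) :=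
  have := D.P.fin 0
  have := D.Q.fin 0
  inferInstance

/-- The short exact sequence of first syzygies. -/
noncomputable def next (hJ : J ≤ jacobsonRad R) (D : HorseshoeDatum R J) : HorseshoeDatum R J :=
  have := D.cover_projective
  have := D.cover_finite
  { K := LinearMap.ker D.P.aug
    M := LinearMap.ker D.cover
    N := LinearMap.ker D.Q.aug
    f := (LinearMap.inl R (D.P.obj 0) (D.Q.obj 0)).restrict fun p (hp : D.P.aug p = 0) => by
      simp [cover_apply, hp]
    g := (LinearMap.snd R (D.P.obj 0) (D.Q.obj 0)).restrict fun _ hx => D.aug_snd_eq_zero hx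
    injective := fun a b hab => Subtype.ext (congrArg (fun x => x.1.1) hab)
    surjective := by
      rintro ⟨q, hq⟩
      obtain ⟨p, hp⟩ := D.exists_cover_eq (q := q) (m := 0) (by rw [map_zero]; exact hq)
      exact ⟨⟨(p, q), hp⟩, rfl⟩
    range_eq_ker := by
      ext ⟨⟨p, q⟩, hx⟩
      constructor
      · rintro ⟨y, hy⟩
        exact Subtype.ext (congrArg (fun x => x.1.2) hy).symm
      · intro h
        obtain rfl : q = 0 := congrArg Subtype.val h
        have hp : D.f (D.P.aug p) = 0 := by simpa [cover_apply] using hx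
        exact ⟨⟨p, (map_eq_zero_iff _ D.injective).1 hp⟩, rfl⟩
    δ := fun n => D.δ (n + 1)
    P := D.P.tail D.P.aug (LinearEquiv.refl R _) fun _ => rfl
    Q := D.Q.tail D.Q.aug (LinearEquiv.refl R _) fun _ => rfl
    koszul_P := D.koszul_P.tail _ _ _
    koszul_M := (D.koszul_M.of_projCover hJ D.cover_surjective D.ker_cover_le).2
    mem_of_map_mem := by
      intro x hx
      have h := (D.koszul_M.of_projCover hJ D.cover_surjective D.ker_cover_le).1
        ((mem_jSMul_top_coe_iff _ _).1 hx)
      have hx' : (x : D.P.obj 0) ∈ jPowSMul J (D.δ 1 - D.δ 0 + 1) ⊤ :=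
        map_mem_jPowSMul_top (LinearMap.fst R (D.P.obj 0) (D.Q.obj 0)) _ h
      rw [mem_jSMul_top_coe_iff]
      exact (D.koszul_P 0).2 ▸ ⟨x.2, hx'⟩ }

/-- The short exact sequence of `n`-th syzygies. -/
noncomputable def iter (hJ : J ≤ jacobsonRad R) (D : HorseshoeDatum R J) :
    ℕ → HorseshoeDatum R J
  | 0 => D
  | n + 1 => (D.iter hJ n).next hJ

theorem minimalHorseshoe (hJ : J ≤ jacobsonRad R) : MinimalHorseshoe J D.f D.g := by
  let S := D.iter hJ
  refine ⟨
    .splice (fun n => (S n).K) (fun n => (S n).P.obj 0) (fun n => (S n).P.proj 0)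
      (fun n => (S n).P.fin 0) (fun n => (S n).P.aug)
      (fun n => (LinearMap.ker (S n).P.aug).subtype) (fun n => (S n).P.aug_surj)
      (fun n => Submodule.subtype_injective _) (fun n => Submodule.range_subtype _)
      (fun n => (S n).P.minimal0),
    .splice (fun n => (S n).M) (fun n => (S n).P.obj 0 × (S n).Q.obj 0)
      (fun n => (S n).cover_projective) (fun n => (S n).cover_finite) (fun n => (S n).cover)
      (fun n => (LinearMap.ker (S n).cover).subtype) (fun n => (S n).cover_surjective)
      (fun n => Submodule.subtype_injective _) (fun n => Submodule.range_subtype _)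
      (fun n => (S n).ker_cover_le),
    .splice (fun n => (S n).N) (fun n => (S n).Q.obj 0) (fun n => (S n).Q.proj 0)
      (fun n => (S n).Q.fin 0) (fun n => (S n).Q.aug)
      (fun n => (LinearMap.ker (S n).Q.aug).subtype) (fun n => (S n).Q.aug_surj)
      (fun n => Submodule.subtype_injective _) (fun n => Submodule.range_subtype _)
      (fun n => (S n).Q.minimal0),
    fun n => LinearMap.inl R ((S n).P.obj 0) ((S n).Q.obj 0),
    fun n => LinearMap.snd R ((S n).P.obj 0) ((S n).Q.obj 0), ?_, ?_, ?_, ?_,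
    fun _ _ _ h => congrArg Prod.fst h, fun n q => ⟨((0 : (S n).P.obj 0), q), rfl⟩,
    fun n => (LinearMap.range_inl R ((S n).P.obj 0) ((S n).Q.obj 0)).symm⟩
  · exact LinearMap.coprod_inl _ _
  · exact LinearMap.ext fun x => (D.g_cover x).symm
  · intro n
    have h : (S (n + 1)).cover ∘ₗ LinearMap.inl R _ _ = (S (n + 1)).f ∘ₗ (S (n + 1)).P.aug :=
      LinearMap.coprod_inl _ _
    exact congrArg ((LinearMap.ker (S n).cover).subtype ∘ₗ ·) h
  · intro n
    exact LinearMap.ext fun x => congrArg Subtype.val ((S (n + 1)).g_cover x).symm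

end HorseshoeDatum

theorem MinimalHorseshoe.mem_jSMul_top {R : Type} [Ring R] {J : Ideal R} {K M N : Type}
    [AddCommGroup K] [Module R K] [AddCommGroup M] [Module R M] [AddCommGroup N] [Module R N]
    {f : K →ₗ[R] M} {g : M →ₗ[R] N} (h : MinimalHorseshoe J f g) {x : K}
    (hx : f x ∈ jSMul J (⊤ : Submodule R M)) : x ∈ jSMul J (⊤ : Submodule R K) := by
  obtain ⟨P, L, Q, φ, ψ, hφ, -, -, -, hφi, hψs, hex⟩ := h
  have := Q.proj 0
  obtain ⟨s, hs⟩ := Module.projective_lifting_property (ψ 0) LinearMap.id (hψs 0)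
  have split := (LinearMap.exact_iff.2 (hex 0)).split_tfae'
  obtain ⟨-, r, hr⟩ := (split.out 0 1 rfl rfl).1 ⟨hφi 0, s, hs⟩
  obtain ⟨p, rfl⟩ := P.aug_surj x
  have hp : φ 0 p ∈ jSMul J ⊤ := by
    refine mem_jSMul_top_of_map L.aug_surj L.minimal0 ?_
    rwa [← LinearMap.comp_apply, hφ]
  have := map_mem_jSMul_top (P.aug ∘ₗ r) hp
  rwa [LinearMap.comp_apply, ← LinearMap.comp_apply r, hr] at this

/-- Theorem A: for a short exact sequence of quasi-`δ`-Koszul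
modules over an augmented Noetherian semiperfect algebra, `J·K = K ∩ J·M` iff
the minimal Horseshoe Lemma holds. -/
theorem quasiDeltaKoszul_jsmul_iff_minimalHorseshoe
    {k : Type} [Field k] {R : Type} [Ring R] [Algebra k R] (ε : R →ₐ[k] k)
    [IsNoetherianRing R] (hsp : Semiperfect R) (J : Ideal R)
    (hJ : J = jacobsonRad R)
    (δ : ℕ → ℕ) (hδ : StrictMono δ)
    {K M N : Type} [AddCommGroup K] [Module R K] [AddCommGroup M] [Module R M]
    [AddCommGroup N] [Module R N]
    [Module.Finite R K] [Module.Finite R M] [Module.Finite R N]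
    (f : K →ₗ[R] M) (g : M →ₗ[R] N)
    (hf : Function.Injective f) (hg : Function.Surjective g)
    (hfg : LinearMap.range f = LinearMap.ker g)
    (hK : IsQuasiDeltaKoszul J δ K) (hM : IsQuasiDeltaKoszul J δ M)
    (hN : IsQuasiDeltaKoszul J δ N) :
    Submodule.map f (jSMul J (⊤ : Submodule R K)) =
      LinearMap.range f ⊓ jSMul J (⊤ : Submodule R M) ↔
    MinimalHorseshoe J f g := by
  obtain rfl := hJ
  have map_le : Submodule.map f (jSMul (jacobsonRad R) (⊤ : Submodule R K)) ≤
      LinearMap.range f ⊓ jSMul (jacobsonRad R) (⊤ : Submodule R M) := by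
    rintro _ ⟨x, hx, rfl⟩
    exact ⟨⟨x, rfl⟩, map_mem_jSMul_top f hx⟩
  constructor
  · intro h
    obtain ⟨P, hP⟩ := hK
    obtain ⟨Q, -⟩ := hN
    refine HorseshoeDatum.minimalHorseshoe
      { K, M, N, f, g, δ, P, Q
        injective := hf
        surjective := hg
        range_eq_ker := hfg
        koszul_P := hP
        koszul_M := hM
        mem_of_map_mem := fun x hx => ?_ } le_rfl
    obtain ⟨y, hy, hyx⟩ := h.ge ⟨⟨x, rfl⟩, hx⟩
    exact hf hyx ▸ hy
  · intro h
    refine le_antisymm map_le ?_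
    rintro _ ⟨⟨x, rfl⟩, hx⟩
    exact ⟨x, h.mem_jSMul_top hx, rfl⟩
end

section
/- Let R be an augmented Noetherian semiperfect algebra with Jacobson radical J and let 0 → K → M → N → 0 be a short exact sequence of finitely generated R-modules with J·K = K ∩ J·M (identifying K with its image in M). Then M is projective if and only if both K and N are projective. -/
theorem jSMul_eq_smul_s9 {R : Type} [Ring R] {M : Type} [AddCommGroup M] [Module R M]
    (I : Ideal R) (K : Submodule R M) : jSMul I K = I • K := by
  apply le_antisymm
  · refine Submodule.span_le.mpr ?_
    rintro _ ⟨r, hr, x, hx, rfl⟩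
    exact Submodule.smul_mem_smul hr hx
  · exact Submodule.smul_le.mpr fun r hr x hx ↦ Submodule.subset_span ⟨r, hr, x, hx, rfl⟩

theorem LinearMap.map_mem_smul_top {R A B : Type*} [Ring R] [AddCommGroup A] [Module R A]
    [AddCommGroup B] [Module R B] {J : Ideal R} (h : A →ₗ[R] B) {x : A}
    (hx : x ∈ J • (⊤ : Submodule R A)) : h x ∈ J • (⊤ : Submodule R B) := by
  have := Submodule.mem_map_of_mem (f := h) hx
  rw [Submodule.map_smul''] at this
  exact Submodule.smul_mono le_rfl le_top this

/-- A surjection from a finite module onto a projective module whose kernel lies in the Jacobson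
radical multiple of the source is injective. -/
theorem LinearMap.injective_of_ker_le_jacobson_smul {R P M : Type*} [Ring R]
    [AddCommGroup P] [Module R P] [AddCommGroup M] [Module R M]
    [Module.Finite R P] [Module.Projective R M] (l : P →ₗ[R] M) (hl : Function.Surjective l)
    (hker : LinearMap.ker l ≤ Ring.jacobson R • (⊤ : Submodule R P)) :
    Function.Injective l := by
  obtain ⟨t, ht⟩ := l.exists_rightInverse_of_surjective (LinearMap.range_eq_top.mpr hl)
  have hlt (x : M) : l (t x) = x := LinearMap.congr_fun ht x
  let e : P →ₗ[R] P := LinearMap.id - t ∘ₗ l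
  have he : LinearMap.ker l = Submodule.map e ⊤ := by
    ext x
    simp only [LinearMap.mem_ker, Submodule.mem_map, Submodule.mem_top, true_and]
    constructor
    · intro hx
      exact ⟨x, by simp [e, hx]⟩
    · rintro ⟨y, rfl⟩
      simp [e, hlt]
  rw [← LinearMap.ker_eq_bot]
  refine Submodule.FG.eq_bot_of_le_jacobson_smul ?_ ?_
  · exact he ▸ Module.Finite.fg_top.map e
  · intro x hx
    have hex : e x = x := by simp [e, LinearMap.mem_ker.mp hx]
    have := Submodule.mem_map_of_mem (f := e) (hker hx)
    rwa [Submodule.map_smul'', ← he, hex] at this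

/-- For covers `q` of `K` and `p` of `N` with `s` a lift of `p` to `M`, the horseshoe map
`Q × P → M` has its kernel in `J • (Q × P)`, provided `K ∩ J • M ≤ J • K`. -/
theorem LinearMap.ker_coprod_le_smul_top {R K M N P Q : Type*} [Ring R] {J : Ideal R}
    [AddCommGroup K] [Module R K] [AddCommGroup M] [Module R M] [AddCommGroup N] [Module R N]
    [AddCommGroup P] [Module R P] [AddCommGroup Q] [Module R Q]
    {f : K →ₗ[R] M} {g : M →ₗ[R] N} (hf : Function.Injective f) (hgf : g ∘ₗ f = 0)
    (hJK : LinearMap.range f ⊓ J • (⊤ : Submodule R M) ≤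
      Submodule.map f (J • (⊤ : Submodule R K)))
    {q : Q →ₗ[R] K} (hq : Function.Surjective q)
    (hqker : LinearMap.ker q ≤ J • (⊤ : Submodule R Q))
    {p : P →ₗ[R] N} (hpker : LinearMap.ker p ≤ J • (⊤ : Submodule R P))
    {s : P →ₗ[R] M} (hs : g ∘ₗ s = p) :
    LinearMap.ker ((f ∘ₗ q).coprod s) ≤ J • (⊤ : Submodule R (Q × P)) := by
  rintro ⟨a, b⟩ hab
  have hab' : f (q a) + s b = 0 := by simpa using hab
  have hpb : p b = 0 := by
    have := congrArg g hab'
    rwa [map_add, map_zero, ← LinearMap.comp_apply g f, hgf, LinearMap.zero_apply, zero_add,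
      ← LinearMap.comp_apply g s, hs] at this
  have hb : b ∈ J • (⊤ : Submodule R P) := hpker hpb
  have hfq : f (q a) ∈ J • (⊤ : Submodule R M) := by
    rw [eq_neg_of_add_eq_zero_left hab']
    exact neg_mem (s.map_mem_smul_top hb)
  have hqa : q a ∈ J • (⊤ : Submodule R K) := by
    obtain ⟨y, hy, hyq⟩ := hJK ⟨⟨q a, rfl⟩, hfq⟩
    exact hf hyq ▸ hy
  have ha : a ∈ J • (⊤ : Submodule R Q) := by
    rw [← LinearMap.range_eq_top.mpr hq, LinearMap.range_eq_map, ← Submodule.map_smul''] at hqa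
    obtain ⟨a', ha', haa⟩ := hqa
    have : a - a' ∈ LinearMap.ker q := by simp [haa]
    simpa using add_mem (hqker this) ha'
  have := add_mem ((LinearMap.inl R Q P).map_mem_smul_top ha)
    ((LinearMap.inr R Q P).map_mem_smul_top hb)
  simpa using this

/-- Theorem C(1): if `J·K = K ∩ J·M` for the short exact sequence
`0 → K → M → N → 0`, then `M` is projective iff both `K` and `N` are. -/
theorem projective_iff_of_jsmul_eq
    {k : Type} [Field k] {R : Type} [Ring R] [Algebra k R] (ε : R →ₐ[k] k)
    [IsNoetherianRing R] (hsp : Semiperfect R) (J : Ideal R)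
    (hJ : J = jacobsonRad R)
    {K M N : Type} [AddCommGroup K] [Module R K] [AddCommGroup M] [Module R M]
    [AddCommGroup N] [Module R N]
    [Module.Finite R K] [Module.Finite R M] [Module.Finite R N]
    (f : K →ₗ[R] M) (g : M →ₗ[R] N)
    (hf : Function.Injective f) (hg : Function.Surjective g)
    (hfg : LinearMap.range f = LinearMap.ker g)
    (hJK : Submodule.map f (jSMul J (⊤ : Submodule R K)) =
      LinearMap.range f ⊓ jSMul J (⊤ : Submodule R M)) :
    Module.Projective R M ↔ Module.Projective R K ∧ Module.Projective R N := by
  have hex : Function.Exact f g := LinearMap.exact_iff.mpr hfg.symm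
  constructor
  · intro hM
    subst hJ
    simp only [jSMul_eq_smul_s9] at hJK
    obtain ⟨CK⟩ := hsp K inferInstance
    obtain ⟨CN⟩ := hsp N inferInstance
    have hKker := CK.ker_le
    have hNker := CN.ker_le
    rw [jSMul_eq_smul_s9] at hKker hNker
    have := CK.proj
    have := CN.proj
    have := CK.fin
    have := CN.fin
    obtain ⟨s, hs⟩ := Module.projective_lifting_property g CN.p hg
    have hgs (b : CN.P) : g (s b) = CN.p b := LinearMap.congr_fun hs b
    have hlift (x : M) (b : CN.P) (hb : CN.p b = g x) : ∃ a, f (CK.p a) + s b = x := by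
      obtain ⟨y, hy⟩ := (hex (x - s b)).mp (by simp [hgs, hb])
      obtain ⟨a, rfl⟩ := CK.surj y
      exact ⟨a, by simp [hy]⟩
    have hinj : Function.Injective ((f ∘ₗ CK.p).coprod s) := by
      refine LinearMap.injective_of_ker_le_jacobson_smul _ (fun x ↦ ?_) ?_
      · obtain ⟨b, hb⟩ := CN.surj (g x)
        obtain ⟨a, ha⟩ := hlift x b hb
        exact ⟨(a, b), by simpa using ha⟩
      · rw [← Ideal.jacobson_bot]
        exact LinearMap.ker_coprod_le_smul_top hf hex.linearMap_comp_eq_zero hJK.ge CK.surj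
          hKker hNker hs
    have hker := (injective_iff_map_eq_zero _).mp hinj
    constructor
    · refine Module.Projective.of_equiv (LinearEquiv.ofBijective CK.p ⟨?_, CK.surj⟩)
      refine (injective_iff_map_eq_zero _).mpr fun a ha ↦ ?_
      exact congrArg Prod.fst (hker (a, 0) (by simp [ha]))
    · refine Module.Projective.of_equiv (LinearEquiv.ofBijective CN.p ⟨?_, CN.surj⟩)
      refine (injective_iff_map_eq_zero _).mpr fun b hb ↦ ?_
      obtain ⟨a, ha⟩ := hlift 0 b (by simp [hb])
      exact congrArg Prod.snd (hker (a, b) (by simpa using ha))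
  · rintro ⟨hK, hN⟩
    obtain ⟨t, ht⟩ := g.exists_rightInverse_of_surjective (LinearMap.range_eq_top.mpr hg)
    exact Module.Projective.of_equiv (hex.splitSurjectiveEquiv hf ⟨t, ht⟩).1.symm
end
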